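/- arXiv:2009.07801 — 4 statements merged into one kernel-verified Lean document; each statement's English description precedes it below -/
import Mathlib

section
/- For every s ≥ 1, β > 0, and all y, ŷ ∈ {0,1}^s, the negated F_β-measure factorizes as −F_β(y,ŷ) = a_{y,0}·b_{ŷ,0} + Σ_{j=1}^s Σ_{k=1}^s a_{y,jk}·b_{ŷ,jk}, where a_{y,0} = 1(‖y‖₁=0), a_{y,jk} = 1(‖y‖₁=k)·y_j, b_{ŷ,0} = −1(‖ŷ‖₁=0), and b_{ŷ,jk} = −(1+β²)·ŷ_j/(β²k + ‖ŷ‖₁). -/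
open Finset

/-- Number of ones in a labeling `y ∈ {0,1}^s`. -/
def cnt {s : ℕ} (y : Fin s → Bool) : ℕ :=
  (Finset.univ.filter (fun j => y j = true)).card

/-- Real-valued indicator of a boolean. -/
noncomputable def indR (b : Bool) : ℝ := if b then 1 else 0

/-- The F_β measure of a predicted labeling `yh` against a true labeling `y`,
with the convention `F_β(0,0) = 1`. -/
noncomputable def Fb (s : ℕ) (β : ℝ) (y yh : Fin s → Bool) : ℝ :=
  if cnt y = 0 ∧ cnt yh = 0 then 1
  else ((1 + β ^ 2) * ∑ j, indR (y j) * indR (yh j)) /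
    (β ^ 2 * (cnt y : ℝ) + (cnt yh : ℝ))

/-- Index set for the `s² + 1` coordinates: `none` is the coordinate `0`,
and `some (j,k)` is the coordinate `(j,k) ∈ [s] × [s]` (with `k` encoding `k+1`). -/
abbrev Coord (s : ℕ) := Option (Fin s × Fin s)

/-- The vector `a_y ∈ {0,1}^{s²+1}`. -/
noncomputable def aVec (s : ℕ) (y : Fin s → Bool) : Coord s → ℝ
  | none => if cnt y = 0 then 1 else 0
  | some (j, k) => (if cnt y = (k : ℕ) + 1 then 1 else 0) * indR (y j)

/-- The vector `b_yh ∈ ℝ^{s²+1}`. -/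
noncomputable def bVec (s : ℕ) (β : ℝ) (yh : Fin s → Bool) : Coord s → ℝ
  | none => if cnt yh = 0 then -1 else 0
  | some (j, k) => -((1 + β ^ 2) * indR (yh j)) / (β ^ 2 * ((k : ℕ) + 1) + (cnt yh : ℝ))

theorem indR_eq_zero_of_cnt_eq_zero {s : ℕ} {y : Fin s → Bool} (h : cnt y = 0) (j : Fin s) :
    indR (y j) = 0 := by
  have hj : ¬ y j = true := Finset.filter_eq_empty_iff.mp (Finset.card_eq_zero.mp h)
    (Finset.mem_univ j)
  simp [indR, hj]

theorem cnt_le {s : ℕ} (y : Fin s → Bool) : cnt y ≤ s := by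
  simpa [cnt] using Finset.card_filter_le Finset.univ (fun j => y j = true)

/-- the negated F_β-measure factorizes as
`−F_β(y,yh) = a_{y,0}·b_{yh,0} + Σ_{j,k} a_{y,jk}·b_{yh,jk}`. -/
theorem neg_Fbeta_factorization (s : ℕ) (hs : 1 ≤ s) (β : ℝ) (hβ : 0 < β)
    (y yh : Fin s → Bool) :
    -(Fb s β y yh) = ∑ c : Coord s, aVec s y c * bVec s β yh c := by
  rw [Fintype.sum_option, Fintype.sum_prod_type]
  rcases Nat.eq_zero_or_pos (cnt y) with h | h
  · have hy := indR_eq_zero_of_cnt_eq_zero h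
    by_cases h' : cnt yh = 0 <;> simp [Fb, aVec, bVec, h, h', hy]
  · obtain ⟨m, hm⟩ := Nat.exists_eq_succ_of_ne_zero h.ne'
    have hms : m < s := by have := cnt_le y; omega
    have inner (j : Fin s) : ∑ k : Fin s, aVec s y (some (j, k)) * bVec s β yh (some (j, k)) =
        indR (y j) * (-((1 + β ^ 2) * indR (yh j)) / (β ^ 2 * (cnt y : ℝ) + (cnt yh : ℝ))) := by
      rw [Finset.sum_eq_single (⟨m, hms⟩ : Fin s)]
      · simp [aVec, bVec, hm]
      · intro k _ hk
        have hne : cnt y ≠ (k : ℕ) + 1 := fun e => hk (Fin.ext (by simp only; omega))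
        simp [aVec, hne]
      · simp
    simp only [inner]
    simp only [Fb, aVec, h.ne', false_and, if_false, zero_mul, zero_add]
    rw [Finset.mul_sum, Finset.sum_div, ← Finset.sum_neg_distrib]
    exact Finset.sum_congr rfl fun j _ => by ring
end

section
/- (Proposition 1) For every s ≥ 1 and β > 0, the 2^s × 2^s real matrix M indexed by pairs (y,ŷ) ∈ {0,1}^s × {0,1}^s with entries M_{y,ŷ} = ℓ^{F_β}_{y,ŷ} − 1 = −F_β(y,ŷ) has rank at most s² + 1. -/
open Finset

theorem sum_aVec_mul_bVec (s : ℕ) (β : ℝ) (y yh : Fin s → Bool) :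
    ∑ c, aVec s y c * bVec s β yh c = -Fb s β y yh := by
  rw [Fintype.sum_option, Fintype.sum_prod_type]
  simp only [aVec, bVec, Fb]
  by_cases hy : cnt y = 0
  · by_cases hyh : cnt yh = 0
    · simp [hy, hyh]
    · simp [hy, hyh, indR_eq_zero_of_cnt_eq_zero hy]
  · obtain ⟨k, hk⟩ : ∃ k : Fin s, cnt y = (k : ℕ) + 1 :=
      ⟨⟨cnt y - 1, by have := cnt_le y; omega⟩, by simp only; omega⟩
    simp only [hy, false_and, if_false, zero_mul, zero_add]
    rw [Finset.mul_sum, Finset.sum_div, ← Finset.sum_neg_distrib]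
    refine Finset.sum_congr rfl fun j _ => ?_
    rw [Finset.sum_eq_single k]
    · rw [if_pos hk, hk]
      push_cast
      ring
    · intro b _ hb
      rw [if_neg fun h => hb (Fin.ext (by omega))]
      simp
    · simp

/-- Proposition 1: the `2^s × 2^s` matrix with entries
`ℓ^{F_β}_{y,yh} − 1 = −F_β(y,yh)` has rank at most `s² + 1`. -/
theorem rank_neg_Fbeta_le (s : ℕ) (hs : 1 ≤ s) (β : ℝ) (hβ : 0 < β) :
    Matrix.rank (Matrix.of fun y yh : Fin s → Bool => -(Fb s β y yh)) ≤ s ^ 2 + 1 := by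
  have h : (Matrix.of fun y yh : Fin s → Bool => -(Fb s β y yh)) =
      (Matrix.of (aVec s)) * (Matrix.of (bVec s β)).transpose := by
    ext y yh
    simp only [Matrix.mul_apply, Matrix.transpose_apply, Matrix.of_apply, sum_aVec_mul_bVec]
  rw [h]
  refine (Matrix.rank_mul_le_left _ _).trans ((Matrix.rank_le_card_width _).trans_eq ?_)
  simp [Coord, sq]
end

section
/- For every s ≥ 1, β > 0, and every ŷ ∈ {0,1}^s with ŷ ≠ 0, the squared Euclidean norm of the vector b_ŷ satisfies ‖b_ŷ‖₂² = (1+β²)² · Σ_{k=1}^s ‖ŷ‖₁/(β²k + ‖ŷ‖₁)², and consequently ‖b_ŷ‖₂² ≤ ((1+β²)²/(4β²)) · (ln s + 1). -/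
open Finset

theorem cnt_pos {s : ℕ} {y : Fin s → Bool} (hy : y ≠ fun _ => false) : 0 < cnt y := by
  obtain ⟨j, hj⟩ := Function.ne_iff.mp hy
  exact Finset.card_pos.mpr ⟨j, by simpa using hj⟩

theorem sum_indR_sq {s : ℕ} (y : Fin s → Bool) : ∑ j, indR (y j) ^ 2 = (cnt y : ℝ) := by
  simp [indR, cnt]

theorem sum_bVec_sq (s : ℕ) (β : ℝ) {yh : Fin s → Bool} (hyh : yh ≠ fun _ => false) :
    ∑ c : Coord s, (bVec s β yh c) ^ 2
      = (1 + β ^ 2) ^ 2 *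
          ∑ k ∈ Finset.Icc 1 s, (cnt yh : ℝ) / (β ^ 2 * (k : ℝ) + (cnt yh : ℝ)) ^ 2 := by
  have hreindex : ∑ k ∈ Finset.Icc 1 s, (cnt yh : ℝ) / (β ^ 2 * (k : ℝ) + (cnt yh : ℝ)) ^ 2
      = ∑ k : Fin s, (cnt yh : ℝ) / (β ^ 2 * ((k : ℕ) + 1) + (cnt yh : ℝ)) ^ 2 := by
    rw [Fin.sum_univ_eq_sum_range
        (fun k => (cnt yh : ℝ) / (β ^ 2 * ((k : ℝ) + 1) + (cnt yh : ℝ)) ^ 2) s,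
      Finset.range_eq_Ico, ← Finset.Ico_add_one_right_eq_Icc,
      ← Finset.sum_Ico_add' _ 0 s 1]
    simp
  rw [Fintype.sum_option, Fintype.sum_prod_type_right, hreindex, Finset.mul_sum]
  simp only [bVec, (cnt_pos hyh).ne', if_false, ne_eq, OfNat.ofNat_ne_zero, not_false_eq_true,
    zero_pow, zero_add]
  refine Finset.sum_congr rfl fun k _ => ?_
  simp only [div_pow, neg_sq, mul_pow]
  rw [← Finset.sum_div, ← Finset.mul_sum, sum_indR_sq, mul_div_assoc]

theorem div_add_sq_le {a b : ℝ} (ha : 0 < a) (hb : 0 < b) :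
    b / (a + b) ^ 2 ≤ 1 / (4 * a) := by
  rw [div_le_div_iff₀ (by positivity) (by positivity)]
  nlinarith [sq_nonneg (a - b)]

theorem sum_div_sq_le (s : ℕ) {β b : ℝ} (hβ : 0 < β) (hb : 0 < b) :
    ∑ k ∈ Finset.Icc 1 s, b / (β ^ 2 * (k : ℝ) + b) ^ 2
      ≤ 1 / (4 * β ^ 2) * (Real.log s + 1) := by
  have hharm : ∑ k ∈ Finset.Icc 1 s, (k : ℝ)⁻¹ ≤ Real.log s + 1 := by
    have h := harmonic_le_one_add_log s
    rw [harmonic_eq_sum_Icc] at h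
    push_cast at h
    linarith
  calc ∑ k ∈ Finset.Icc 1 s, b / (β ^ 2 * (k : ℝ) + b) ^ 2
      ≤ ∑ k ∈ Finset.Icc 1 s, 1 / (4 * β ^ 2) * (k : ℝ)⁻¹ := by
        refine Finset.sum_le_sum fun k hk => ?_
        have hk : (0 : ℝ) < k := by exact_mod_cast (Finset.mem_Icc.mp hk).1
        refine (div_add_sq_le (by positivity) hb).trans_eq ?_
        field_simp
    _ ≤ 1 / (4 * β ^ 2) * (Real.log s + 1) := by
        rw [← Finset.mul_sum]
        gcongr

/-- for `yh ≠ 0`, the squared Euclidean norm of `b_yh` equals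
`(1+β²)² Σ_{k=1}^s ‖yh‖₁/(β²k + ‖yh‖₁)²`, and is at most `((1+β²)²/(4β²))(ln s + 1)`. -/
theorem bVec_sq_norm (s : ℕ) (hs : 1 ≤ s) (β : ℝ) (hβ : 0 < β)
    (yh : Fin s → Bool) (hyh : yh ≠ fun _ => false) :
    (∑ c : Coord s, (bVec s β yh c) ^ 2)
        = (1 + β ^ 2) ^ 2 *
            ∑ k ∈ Finset.Icc 1 s, (cnt yh : ℝ) / (β ^ 2 * (k : ℝ) + (cnt yh : ℝ)) ^ 2
      ∧ (∑ c : Coord s, (bVec s β yh c) ^ 2)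
          ≤ (1 + β ^ 2) ^ 2 / (4 * β ^ 2) * (Real.log s + 1) := by
  refine ⟨sum_bVec_sq s β hyh, (sum_bVec_sq s β hyh).trans_le ?_⟩
  rw [div_eq_mul_one_div, mul_assoc]
  gcongr
  exact sum_div_sq_le s hβ (by exact_mod_cast cnt_pos hyh)
end

section
/- The binary logistic loss φ_log(y,u) = ln(1 + e^{−yu}) is 4-strongly proper composite with underlying logit link γ_log(p) = ln(p/(1−p)): for all q ∈ [0,1] and all u ∈ ℝ, q·(φ_log(+1,u) − φ_log(+1,γ_log(q))) + (1−q)·(φ_log(−1,u) − φ_log(−1,γ_log(q))) ≥ 2·(σ(u) − q)², where σ(u) = 1/(1+e^{−u}) = γ_log⁻¹(u) (with the boundary cases q = 0 and q = 1 interpreted by continuity). -/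
/-- The binary logistic loss `φ_log(y,u) = ln(1 + e^{−yu})`, with `true` standing for
the label `+1` and `false` for `−1`. -/
noncomputable def philog (y : Bool) (u : ℝ) : ℝ :=
  Real.log (1 + Real.exp (-(if y then u else -u)))

/-- The logit link `γ_log(p) = ln(p/(1−p))`. -/
noncomputable def logit (p : ℝ) : ℝ := Real.log (p / (1 - p))

/-- The sigmoid `σ(u) = 1/(1+e^{−u}) = γ_log⁻¹(u)`. -/
noncomputable def sigm (u : ℝ) : ℝ := 1 / (1 + Real.exp (-u))

/-- Binary Pinsker inequality, in terms of the binary cross-entropy. -/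
theorem binary_pinsker {p q : ℝ} (hp : p ∈ Set.Ioo (0 : ℝ) 1) (hq : q ∈ Set.Icc (0 : ℝ) 1) :
    2 * (p - q) ^ 2 ≤ -(q * Real.log p + (1 - q) * Real.log (1 - p)) - Real.binEntropy q := by
  set f : ℝ → ℝ := fun x =>
    -(x * Real.log p + (1 - x) * Real.log (1 - p)) - Real.binEntropy x - 2 * (p - x) ^ 2 with hf
  set f' : ℝ → ℝ := fun x =>
    -(Real.log p - Real.log (1 - p)) - (Real.log (1 - x) - Real.log x) + 4 * (p - x) with hf'
  have deriv_f : ∀ x ∈ Set.Ioo (0 : ℝ) 1, HasDerivAt f (f' x) x := by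
    intro x hx
    have hid := hasDerivAt_id' x
    have h := (((hid.mul_const (Real.log p)).add
      ((hid.const_sub 1).mul_const (Real.log (1 - p)))).neg.sub
        (Real.hasDerivAt_binEntropy hx.1.ne' hx.2.ne)).sub
          (((hid.const_sub p).pow 2).const_mul 2)
    refine h.congr_deriv ?_
    simp only [hf']
    push_cast
    ring
  have deriv_f' : ∀ x ∈ Set.Ioo (0 : ℝ) 1, HasDerivAt f' ((1 - 2 * x) ^ 2 / (x * (1 - x))) x := by
    intro x hx
    have hx0 : x ≠ 0 := hx.1.ne'
    have hx1 : 1 - x ≠ 0 := (sub_pos.2 hx.2).ne'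
    have hid := hasDerivAt_id' x
    have h := ((((hid.const_sub 1).log hx1).sub (hid.log hx0)).const_sub
      (-(Real.log p - Real.log (1 - p)))).add ((hid.const_sub p).const_mul 4)
    refine h.congr_deriv ?_
    field_simp
    ring
  have hconv : ConvexOn ℝ (Set.Icc 0 1) f := by
    refine convexOn_of_hasDerivWithinAt2_nonneg (f' := f')
      (f'' := fun x => (1 - 2 * x) ^ 2 / (x * (1 - x))) (convex_Icc 0 1)
      (by simp only [hf]; fun_prop) ?_ ?_ ?_ <;> rw [interior_Icc] <;> intro x hx
    · exact (deriv_f x hx).hasDerivWithinAt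
    · exact (deriv_f' x hx).hasDerivWithinAt
    · exact div_nonneg (sq_nonneg _) (mul_nonneg hx.1.le (sub_pos.2 hx.2).le)
  have hmin : IsMinOn f (Set.Icc 0 1) p := by
    refine hconv.isMinOn_of_rightDeriv_eq_zero (by rwa [interior_Icc]) ?_
    rw [(deriv_f p hp).hasDerivWithinAt.derivWithin (uniqueDiffWithinAt_Ioi p)]
    simp only [hf']
    ring
  have hle : f p ≤ f q := hmin hq
  have hfp : f p = 0 := by
    simp only [hf, Real.binEntropy, Real.log_inv]
    ring
  rw [hfp] at hle
  simp only [hf] at hle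
  linarith

theorem sigm_eq_sigmoid (u : ℝ) : sigm u = Real.sigmoid u :=
  one_div _

theorem philog_true (u : ℝ) : philog true u = -Real.log (sigm u) := by
  simp [philog, sigm]

theorem philog_false (u : ℝ) : philog false u = -Real.log (1 - sigm u) := by
  rw [sigm_eq_sigmoid, ← Real.sigmoid_neg, ← sigm_eq_sigmoid]
  simp [philog, sigm]

theorem sigm_mem_Ioo (u : ℝ) : sigm u ∈ Set.Ioo (0 : ℝ) 1 := by
  rw [sigm_eq_sigmoid]
  exact ⟨Real.sigmoid_pos u, Real.sigmoid_lt_one u⟩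

theorem sigm_logit {q : ℝ} (hq : q ∈ Set.Ioo (0 : ℝ) 1) : sigm (logit q) = q := by
  have hq0 : q ≠ 0 := hq.1.ne'
  have hq1 : 0 < 1 - q := sub_pos.2 hq.2
  rw [sigm, logit, Real.exp_neg, Real.exp_log (div_pos hq.1 hq1)]
  field_simp
  ring

/-- the binary logistic loss is 4-strongly proper composite with the
logit link: for all `q ∈ [0,1]` and `u ∈ ℝ`,
`q(φ_log(+1,u) − φ_log(+1,γ_log(q))) + (1−q)(φ_log(−1,u) − φ_log(−1,γ_log(q))) ≥ 2(σ(u) − q)²`,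
with the boundary cases `q = 0` and `q = 1` interpreted by continuity. -/
theorem logistic_four_strongly_proper :
    (∀ q ∈ Set.Ioo (0 : ℝ) 1, ∀ u : ℝ,
        q * (philog true u - philog true (logit q))
            + (1 - q) * (philog false u - philog false (logit q))
          ≥ 2 * (sigm u - q) ^ 2)
    ∧ (∀ u : ℝ, philog true u ≥ 2 * (sigm u - 1) ^ 2)
    ∧ (∀ u : ℝ, philog false u ≥ 2 * (sigm u - 0) ^ 2) := by
  refine ⟨fun q hq u => ?_, fun u => ?_, fun u => ?_⟩
  · have h := binary_pinsker (sigm_mem_Ioo u) (Set.Ioo_subset_Icc_self hq)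
    rw [philog_true, philog_true, philog_false, philog_false, sigm_logit hq]
    simp only [Real.binEntropy, Real.log_inv] at h
    linarith
  · have h := binary_pinsker (sigm_mem_Ioo u) (Set.right_mem_Icc.2 zero_le_one)
    rw [philog_true]
    simpa using h
  · have h := binary_pinsker (sigm_mem_Ioo u) (Set.left_mem_Icc.2 zero_le_one)
    rw [philog_false]
    simpa using h
end
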